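/- Fix a real N>0 and 0<δ<1. The integral ∫_{−Nπ}^{Nπ} (S^{N,δ}(x+iy) − (x+iy)) dx does not depend on y: for all y₁,y₂>0, ∫_{−Nπ}^{Nπ}(S^{N,δ}(x+iy₁)−(x+iy₁))dx = ∫_{−Nπ}^{Nπ}(S^{N,δ}(x+iy₂)−(x+iy₂))dx. (Intermediate contour-integration step: the horizontal average of the displacement is invariant under vertical translation, by analyticity of S^{N,δ}(w)−w and periodicity in the horizontal direction.) -/

import Mathlib

open Complex Filter

/-- The map `f_N(z) = exp(-iz/N)` from the cylinder to the complement of the unit disk. -/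
noncomputable def fN (N : ℝ) (z : ℂ) : ℂ := Complex.exp (-Complex.I * z / N)

/-- The inverse map `f_N⁻¹(w) = iN·Log w` (principal branch). -/
noncomputable def fNinv (N : ℝ) (w : ℂ) : ℂ := Complex.I * N * Complex.log w

/-- The Möbius map `g(z) = i(z-1)/(z+1)`. -/
noncomputable def gMap (z : ℂ) : ℂ := Complex.I * (z - 1) / (z + 1)

/-- The inverse Möbius map `g⁻¹(w) = (i+w)/(i-w)`. -/
noncomputable def gInv (w : ℂ) : ℂ := (Complex.I + w) / (Complex.I - w)

/-- The half-plane slit map `φ^δ(z) = z·(1-δ²-δ²/z²)^{1/2}` (principal square root). -/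
noncomputable def phiSlit (δ : ℝ) (z : ℂ) : ℂ :=
  z * (1 - (δ:ℂ)^2 - (δ:ℂ)^2 / z^2) ^ ((1:ℂ)/2)

/-- The cylindrical slit map `S^{N,δ} = f_N⁻¹∘g⁻¹∘φ^δ∘g∘f_N`. -/
noncomputable def cylSlit (N δ : ℝ) (z : ℂ) : ℂ :=
  fNinv N (gInv (phiSlit δ (gMap (fN N z))))

/-- The slit-size parameter `δ(N,λ) = 1 - 2/(1+e^{λ/N})`. -/
noncomputable def deltaN (N lam : ℝ) : ℝ := 1 - 2 / (1 + Real.exp (lam / N))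

/-- The slit map in the coordinate `w = f_N(z)`. -/
noncomputable def slitExterior (δ : ℝ) (w : ℂ) : ℂ := gInv (phiSlit δ (gMap w))

theorem gInv_re (z : ℂ) : (gInv z).re = (1 - normSq z) / normSq (I - z) := by
  simp only [gInv, div_re, ← add_div, normSq_apply]
  congr 1
  simp
  ring

theorem gInv_im (z : ℂ) : (gInv z).im = -2 * z.re / normSq (I - z) := by
  simp only [gInv, div_im, ← sub_div, normSq_apply]
  congr 1
  simp
  ring

theorem add_one_ne_zero_of_one_lt_norm {w : ℂ} (hw : 1 < ‖w‖) : w + 1 ≠ 0 := by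
  intro h
  rw [eq_neg_of_add_eq_zero_left h] at hw
  simp at hw

theorem gInv_gMap {w : ℂ} (hw : 1 < ‖w‖) : gInv (gMap w) = w := by
  have h := add_one_ne_zero_of_one_lt_norm hw
  have h₁ : I + gMap w = I * (2 * w) / (w + 1) := by
    unfold gMap; field_simp; ring
  have h₂ : I - gMap w = I * 2 / (w + 1) := by
    unfold gMap; field_simp; ring
  rw [gInv, h₁, h₂]
  field_simp

theorem gMap_ne_I {w : ℂ} (hw : 1 < ‖w‖) : gMap w ≠ I := by
  have h := add_one_ne_zero_of_one_lt_norm hw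
  intro h'
  have h₂ : I - gMap w = I * 2 / (w + 1) := by
    unfold gMap; field_simp; ring
  rw [h', sub_self] at h₂
  have : I * 2 / (w + 1) ≠ 0 := by simp [h]
  exact this h₂.symm

theorem gMap_im_pos {w : ℂ} (hw : 1 < ‖w‖) : 0 < (gMap w).im := by
  have h := add_one_ne_zero_of_one_lt_norm hw
  have hd : 0 < normSq (w + 1) := normSq_pos.2 h
  have h₁ : (gMap w).im = (normSq w - 1) / normSq (w + 1) := by
    simp only [gMap, div_im, ← sub_div]
    congr 1
    simp [normSq_apply]
    ring
  rw [h₁]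
  refine div_pos ?_ hd
  rw [normSq_eq_norm_sq]
  nlinarith

theorem phiSlit_arg_im_mul {δ : ℝ} {z : ℂ} :
    (1 - (δ:ℂ)^2 - (δ:ℂ)^2 / z^2).im * normSq z ^ 2 = 2 * δ ^ 2 * (z.re * z.im) := by
  by_cases hz : z = 0
  · simp [hz]
  have h : normSq z ≠ 0 := by simpa using hz
  have h2 : (1 - (δ:ℂ)^2 - (δ:ℂ)^2 / z^2).im = δ ^ 2 * (2 * z.re * z.im) / normSq z ^ 2 := by
    simp [div_im, pow_two, ← ofReal_mul]
    field_simp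
    ring
  rw [h2]
  field_simp

theorem phiSlit_arg_mem_slitPlane {δ : ℝ} (hδ1 : δ ^ 2 < 1) {z : ℂ} (hz : 0 < z.im) :
    1 - (δ:ℂ)^2 - (δ:ℂ)^2 / z^2 ∈ slitPlane := by
  have hz0 : z ≠ 0 := by rintro rfl; simp at hz
  have hn : 0 < normSq z := normSq_pos.2 hz0
  rw [mem_slitPlane_iff]
  by_cases hr : z.re = 0
  · left
    have : z = z.im * I := by apply Complex.ext <;> simp [hr]
    have h2 : (1 - (δ:ℂ)^2 - (δ:ℂ)^2 / z^2) = ((1 - δ ^ 2 + δ ^ 2 / z.im ^ 2 : ℝ) : ℂ) := by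
      conv_lhs => rw [this]
      push_cast
      rw [mul_pow, I_sq]
      ring
    rw [h2, ofReal_re]
    have : 0 ≤ δ ^ 2 / z.im ^ 2 := by positivity
    linarith
  · by_cases hδ : δ = 0
    · left; simp [hδ]
    right
    intro h
    have := phiSlit_arg_im_mul (δ := δ) (z := z)
    rw [h, zero_mul] at this
    have h3 : 2 * δ ^ 2 * (z.re * z.im) ≠ 0 := by
      have := hz.ne'
      positivity
    exact h3 this.symm

theorem cpow_one_half_sq (u : ℂ) : (u ^ ((1:ℂ)/2)) ^ 2 = u := by
  have h := cpow_nat_inv_pow u two_ne_zero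
  rwa [Nat.cast_ofNat, ← one_div] at h

theorem phiSlit_sq {δ : ℝ} {z : ℂ} (hz : z ≠ 0) :
    phiSlit δ z ^ 2 = (1 - (δ:ℂ)^2) * z ^ 2 - (δ:ℂ)^2 := by
  rw [phiSlit, mul_pow, cpow_one_half_sq]
  field_simp

theorem phiSlit_im_pos {δ : ℝ} (hδ1 : δ ^ 2 < 1) {z : ℂ} (hz : 0 < z.im) :
    0 < (phiSlit δ z).im := by
  have hz0 : z ≠ 0 := by rintro rfl; simp at hz
  have hn : 0 < normSq z := normSq_pos.2 hz0
  have hu := phiSlit_arg_mem_slitPlane hδ1 hz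
  have him := phiSlit_arg_im_mul (δ := δ) (z := z)
  rw [phiSlit]
  set u := 1 - (δ:ℂ)^2 - (δ:ℂ)^2 / z^2
  have hs : (u ^ ((1:ℂ)/2)) ^ 2 = u := cpow_one_half_sq u
  have hre : 0 < (u ^ ((1:ℂ)/2)).re := by
    rw [cpow_def_of_ne_zero (slitPlane_ne_zero hu), exp_re]
    refine mul_pos (Real.exp_pos _) (Real.cos_pos_of_mem_Ioo ?_)
    have h1 : (log u * (1 / 2)).im = u.arg / 2 := by
      have : (1 / 2 : ℂ) = ((1 / 2 : ℝ) : ℂ) := by push_cast; rfl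
      rw [this, im_mul_ofReal, log_im]; ring
    rw [h1]
    have := neg_pi_lt_arg u
    have := lt_of_le_of_ne (arg_le_pi u) (mem_slitPlane_iff_arg.1 hu).1
    constructor <;> linarith
  set s := u ^ ((1:ℂ)/2)
  have hi : u.im = 2 * (s.re * s.im) := by
    rw [← hs, pow_two, mul_im]; ring
  rw [mul_im]
  have h2 : 0 ≤ z.re * s.im := by
    have h3 : (z.re * s.im) * (s.re * normSq z ^ 2) = δ ^ 2 * z.im * z.re ^ 2 := by
      rw [hi] at him
      linear_combination z.re / 2 * him
    have h4 : 0 ≤ (z.re * s.im) * (s.re * normSq z ^ 2) := by rw [h3]; positivity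
    exact nonneg_of_mul_nonneg_left h4 (by positivity)
  have := mul_pos hz hre
  linarith

theorem phiSlit_ne_I {δ : ℝ} (hδ1 : δ ^ 2 < 1) {z : ℂ} (hz : 0 < z.im) (hzI : z ≠ I) :
    phiSlit δ z ≠ I := by
  intro h
  have hz0 : z ≠ 0 := by rintro rfl; simp at hz
  have hsq := phiSlit_sq (δ := δ) hz0
  rw [h, I_sq] at hsq
  have hc : (1 - (δ:ℂ)^2) ≠ 0 := by
    have : (1 - δ ^ 2 : ℝ) ≠ 0 := by linarith
    exact_mod_cast this
  have h1 : (1 - (δ:ℂ)^2) * ((z - I) * (z + I)) = 0 := by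
    linear_combination -hsq - (1 - (δ:ℂ)^2) * I_sq
  rcases mul_eq_zero.1 h1 with h | h
  · exact hc h
  rcases mul_eq_zero.1 h with h | h
  · exact hzI (sub_eq_zero.1 h)
  · have := congrArg im h
    simp at this
    linarith

/-- The slit map does not move a point across the real axis, and keeps the sign on it. -/
theorem slitExterior_re_im {δ : ℝ} (hδ1 : δ ^ 2 < 1) {w : ℂ} (hw : 1 < ‖w‖) :
    (∃ k > 0, (slitExterior δ w).im = k * w.im) ∧
      (w.im = 0 → 0 < (slitExterior δ w).re * w.re) := by
  have hz := gMap_im_pos hw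
  have hzI := gMap_ne_I hw
  have hgw := gInv_gMap hw
  rw [slitExterior]
  set z := gMap w
  have hz0 : z ≠ 0 := by intro h; simp [h] at hz
  have hp := phiSlit_im_pos hδ1 hz
  have hpI := phiSlit_ne_I hδ1 hz hzI
  have hsq := phiSlit_sq (δ := δ) hz0
  set p := phiSlit δ z
  have hnz : 0 < normSq (I - z) := normSq_pos.2 (sub_ne_zero.2 hzI.symm)
  have hnp : 0 < normSq (I - p) := normSq_pos.2 (sub_ne_zero.2 hpI.symm)
  have hc : 0 < 1 - δ ^ 2 := by linarith
  have hcc : (1 - (δ:ℂ)^2) * z ^ 2 - (δ:ℂ)^2 =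
      ((1 - δ ^ 2 : ℝ) : ℂ) * z ^ 2 - ((δ ^ 2 : ℝ) : ℂ) := by
    push_cast; rfl
  rw [hcc] at hsq
  have hre := congrArg re hsq
  have him := congrArg im hsq
  rw [sub_re, re_ofReal_mul, ofReal_re, pow_two p, pow_two z, mul_re, mul_re] at hre
  rw [sub_im, im_ofReal_mul, ofReal_im, pow_two p, pow_two z, mul_im, mul_im] at him
  have hpr : p.re = (1 - δ ^ 2) * z.im / p.im * z.re := by
    field_simp
    linear_combination him / 2
  rw [← hgw, gInv_im, gInv_im, gInv_re, gInv_re]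
  constructor
  · refine ⟨(1 - δ ^ 2) * z.im / p.im * (normSq (I - z) / normSq (I - p)), by positivity, ?_⟩
    rw [hpr]
    field_simp
  · intro h
    have hzr : z.re = 0 := by
      rcases div_eq_zero_iff.1 h with h | h
      · linarith
      · exact absurd h hnz.ne'
    have hpr0 : p.re = 0 := by rw [hpr, hzr, mul_zero]
    have hzi : 1 - z.im * z.im ≠ 0 := by
      intro h
      apply hzI
      apply Complex.ext
      · simpa using hzr
      · simp only [I_im]; nlinarith
    rw [hpr0, hzr] at hre
    have : 1 - normSq p = (1 - δ ^ 2) * (1 - z.im * z.im) := by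
      rw [normSq_apply, hpr0]; linarith
    rw [this, normSq_apply z, hzr]
    have h5 : (1 - δ ^ 2) * (1 - z.im * z.im) / normSq (I - p) *
        ((1 - (0 * 0 + z.im * z.im)) / normSq (I - z)) =
        (1 - δ ^ 2) * (1 - z.im * z.im) ^ 2 / (normSq (I - p) * normSq (I - z)) := by
      field_simp; ring
    rw [h5]
    positivity

theorem slitExterior_ne_zero {δ : ℝ} (hδ1 : δ ^ 2 < 1) {w : ℂ} (hw : 1 < ‖w‖) :
    slitExterior δ w ≠ 0 := by
  obtain ⟨⟨k, hk, h⟩, h'⟩ := slitExterior_re_im hδ1 hw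
  intro h0
  rw [h0] at h h'
  simp [hk.ne'] at h h'
  exact h' h

theorem slitExterior_div_mem_slitPlane {δ : ℝ} (hδ1 : δ ^ 2 < 1) {w : ℂ} (hw : 1 < ‖w‖) :
    slitExterior δ w / w ∈ slitPlane := by
  obtain ⟨⟨k, hk, h⟩, h'⟩ := slitExterior_re_im hδ1 hw
  have hw0 : w ≠ 0 := by rintro rfl; simp at hw; linarith
  have hn : 0 < normSq w := normSq_pos.2 hw0
  rw [mem_slitPlane_iff, div_re, div_im, ← add_div, ← sub_div]
  set v := slitExterior δ w
  by_cases hi : w.im = 0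
  · left
    refine div_pos ?_ hn
    rw [hi]
    have := h' hi
    linarith
  by_cases hv : v.im * w.re - v.re * w.im = 0
  · left
    have h2 : v.re = k * w.re := by
      have : w.im * (v.re - k * w.re) = 0 := by rw [h] at hv; linarith
      rcases mul_eq_zero.1 this with h | h
      · exact absurd h hi
      · linarith
    refine div_pos ?_ hn
    rw [h, h2]
    have : k * w.re * w.re + k * w.im * w.im = k * normSq w := by rw [normSq_apply]; ring
    rw [this]
    positivity
  · right
    exact div_ne_zero hv hn.ne'

theorem log_slitExterior_div {δ : ℝ} (hδ1 : δ ^ 2 < 1) {w : ℂ} (hw : 1 < ‖w‖)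
    (hs : w ∈ slitPlane) :
    log (slitExterior δ w / w) = log (slitExterior δ w) - log w := by
  obtain ⟨⟨k, hk, h⟩, h'⟩ := slitExterior_re_im hδ1 hw
  have hv0 := slitExterior_ne_zero hδ1 hw
  have hw0 := slitPlane_ne_zero hs
  set v := slitExterior δ w
  have hwarg : w⁻¹.arg = - w.arg := by
    rw [arg_inv, if_neg (mem_slitPlane_iff_arg.1 hs).1]
  have hlt : ∀ u : ℂ, u.im ≠ 0 → u.arg < Real.pi := fun u hu =>
    lt_of_le_of_ne (arg_le_pi u) (mem_slitPlane_iff_arg.1 (Or.inr hu)).1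
  rw [div_eq_mul_inv, log_mul hv0 (inv_ne_zero hw0), log_inv _ (mem_slitPlane_iff_arg.1 hs).1,
    sub_eq_add_neg]
  rw [hwarg]
  have hpi := Real.pi_pos
  rcases lt_trichotomy w.im 0 with hi | hi | hi
  · have hvi : v.im < 0 := by rw [h]; exact mul_neg_of_pos_of_neg hk hi
    have := arg_neg_iff.2 hi
    have := arg_neg_iff.2 hvi
    have := neg_pi_lt_arg v
    have := neg_pi_lt_arg w
    constructor <;> linarith
  · have hwr : 0 < w.re := by
      rcases mem_slitPlane_iff.1 hs with h | h
      · exact h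
      · exact absurd hi h
    have hvr : 0 < v.re := pos_of_mul_pos_left (h' hi) hwr.le
    have hvi : v.im = 0 := by rw [h, hi, mul_zero]
    rw [arg_eq_zero_iff.2 ⟨hwr.le, hi⟩, arg_eq_zero_iff.2 ⟨hvr.le, hvi⟩]
    constructor <;> linarith
  · have hvi : 0 < v.im := by rw [h]; exact mul_pos hk hi
    have := arg_nonneg_iff.2 hi.le
    have := arg_nonneg_iff.2 hvi.le
    have := hlt v hvi.ne'
    have := hlt w hi.ne'
    constructor <;> linarith

theorem differentiableAt_slitExterior {δ : ℝ} (hδ1 : δ ^ 2 < 1) {w : ℂ} (hw : 1 < ‖w‖) :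
    DifferentiableAt ℂ (slitExterior δ) w := by
  have hz := gMap_im_pos hw
  have hz0 : gMap w ≠ 0 := by intro h; simp [h] at hz
  have hg : DifferentiableAt ℂ gMap w := by
    unfold gMap
    exact DifferentiableAt.div (by fun_prop) (by fun_prop) (add_one_ne_zero_of_one_lt_norm hw)
  have hp : DifferentiableAt ℂ (phiSlit δ) (gMap w) := by
    unfold phiSlit
    refine differentiableAt_id.mul (DifferentiableAt.cpow_const ?_ (phiSlit_arg_mem_slitPlane hδ1 hz))
    exact (differentiableAt_const _).sub
      ((differentiableAt_const _).div (by fun_prop) (pow_ne_zero 2 hz0))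
  have hq : DifferentiableAt ℂ gInv (phiSlit δ (gMap w)) := by
    unfold gInv
    exact DifferentiableAt.div (by fun_prop) (by fun_prop)
      (sub_ne_zero.2 (phiSlit_ne_I hδ1 hz (gMap_ne_I hw)).symm)
  exact DifferentiableAt.comp w hq (DifferentiableAt.comp w hp hg)

theorem one_lt_norm_fN {N : ℝ} (hN : 0 < N) {z : ℂ} (hz : 0 < z.im) : 1 < ‖fN N z‖ := by
  rw [fN, norm_exp, Real.one_lt_exp_iff, div_ofReal_re]
  have : (-I * z).re = z.im := by simp
  rw [this]
  positivity

/-- The holomorphic, horizontally periodic version of the displacement `S^{N,δ}(z) - z`. -/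
noncomputable def cylDisplacement (N δ : ℝ) (z : ℂ) : ℂ :=
  I * N * log (slitExterior δ (fN N z) / fN N z)

theorem differentiableAt_cylDisplacement {N δ : ℝ} (hN : 0 < N) (hδ1 : δ ^ 2 < 1) {z : ℂ}
    (hz : 0 < z.im) : DifferentiableAt ℂ (cylDisplacement N δ) z := by
  have hw := one_lt_norm_fN hN hz
  have hf : DifferentiableAt ℂ (fN N) z := by unfold fN; fun_prop
  have hS := DifferentiableAt.comp z (differentiableAt_slitExterior hδ1 hw) hf
  exact ((hS.div hf (exp_ne_zero _)).clog (slitExterior_div_mem_slitPlane hδ1 hw)).const_mul _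

theorem fN_add_two_pi {N : ℝ} (hN : N ≠ 0) (z : ℂ) : fN N (z + 2 * (N * Real.pi)) = fN N z := by
  have hN' : (N : ℂ) ≠ 0 := by exact_mod_cast hN
  have : -I * (z + 2 * (N * Real.pi)) / N = -I * z / N - 2 * Real.pi * I := by
    field_simp
    ring
  rw [fN, this, exp_periodic.sub_eq, fN]

theorem cylSlit_sub_self {N δ : ℝ} (hN : 0 < N) (hδ1 : δ ^ 2 < 1) {z : ℂ} (hz : 0 < z.im)
    (hl : -(N * Real.pi) < z.re) (hr : z.re < N * Real.pi) :
    cylSlit N δ z - z = cylDisplacement N δ z := by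
  have hN' : (N : ℂ) ≠ 0 := by exact_mod_cast hN.ne'
  have him : (-I * z / N).im = -z.re / N := by
    rw [div_ofReal_im]; simp
  have h1 : -Real.pi < -z.re / N := by rw [lt_div_iff₀ hN]; linarith
  have h2 : -z.re / N < Real.pi := by rw [div_lt_iff₀ hN]; linarith
  have hlog : log (fN N z) = -I * z / N := log_exp (by rwa [him]) (by rw [him]; exact h2.le)
  have hs : fN N z ∈ slitPlane := by
    rw [mem_slitPlane_iff_arg]
    refine ⟨?_, exp_ne_zero _⟩
    rw [← log_im, hlog, him]
    exact h2.ne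
  rw [cylDisplacement, log_slitExterior_div hδ1 (one_lt_norm_fN hN hz) hs, hlog, cylSlit, fNinv,
    slitExterior, mul_sub]
  congr 1
  field_simp
  linear_combination z * I_sq

/-- The horizontal average of the displacement is invariant under vertical translation. -/
theorem integral_displacement_indep_of_height (N δ : ℝ) (hN : 0 < N) (hδ : 0 < δ) (hδ1 : δ < 1)
    (y₁ y₂ : ℝ) (hy₁ : 0 < y₁) (hy₂ : 0 < y₂) :
    (∫ x : ℝ in (-(N * Real.pi))..(N * Real.pi),
        (cylSlit N δ (x + y₁ * Complex.I) - (x + y₁ * Complex.I)))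
      = (∫ x : ℝ in (-(N * Real.pi))..(N * Real.pi),
        (cylSlit N δ (x + y₂ * Complex.I) - (x + y₂ * Complex.I))) := by
  have hd : δ ^ 2 < 1 := by nlinarith
  have hle : -(N * Real.pi) ≤ N * Real.pi := by
    have := mul_pos hN Real.pi_pos
    linarith
  have key : ∀ y : ℝ, 0 < y →
      (∫ x : ℝ in (-(N * Real.pi))..(N * Real.pi), (cylSlit N δ (x + y * I) - (x + y * I)))
        = ∫ x : ℝ in (-(N * Real.pi))..(N * Real.pi), cylDisplacement N δ (x + y * I) := by
    intro y hy
    refine intervalIntegral.integral_congr_Ioo_of_le hle fun x hx => ?_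
    exact cylSlit_sub_self hN hd (by simpa using hy) (by simpa using hx.1) (by simpa using hx.2)
  rw [key y₁ hy₁, key y₂ hy₂]
  have hrect := integral_boundary_rect_eq_zero_of_differentiableOn (cylDisplacement N δ)
    ((-(N * Real.pi) : ℝ) + y₁ * I) ((N * Real.pi : ℝ) + y₂ * I) (by
      intro z hz
      refine (differentiableAt_cylDisplacement hN hd ?_).differentiableWithinAt
      have := (mem_reProdIm.1 hz).2.1
      simp at this
      rcases this with h | h <;> linarith)
  have hside : ∀ y : ℝ, cylDisplacement N δ ((N * Real.pi : ℝ) + y * I)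
      = cylDisplacement N δ ((-(N * Real.pi) : ℝ) + y * I) := by
    intro y
    have : ((N * Real.pi : ℝ) + y * I : ℂ)
        = ((-(N * Real.pi) : ℝ) + y * I) + 2 * (N * Real.pi) := by
      push_cast; ring
    rw [cylDisplacement, cylDisplacement, this, fN_add_two_pi hN.ne']
  simp only [add_re, add_im, ofReal_re, ofReal_im, mul_re, mul_im, I_re, I_im, mul_zero, mul_one,
    sub_zero, add_zero, zero_add, hside, add_sub_cancel_right] at hrect
  exact sub_eq_zero.1 hrect
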